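/- Let n ≥ 3 and δ ∈ (0,(n−1)/(n+1)). Let μ ∈ Δ^n_+ satisfy μ_(1) = 1−δ, and let R(μ) = Ř(Ř(...Ř(μ)...)) denote the n-fold composition of the split-merge prerule applied to μ. Then max_i [R(μ)]_i < 1−δ strictly; i.e., the split-merge regulation rule maps the boundary set {μ ∈ Δ^n_+ : μ_(1) = 1−δ} into the open regulatory set U^μ = {μ ∈ Δ^n_+ : μ_(1) < 1−δ}. -/

import Mathlib

open scoped BigOperators

/-- The open unit simplex `Δ⁺ₙ`. -/
def simplexPos (n : ℕ) : Set (Fin n → ℝ) := {μ | (∀ i, 0 < μ i) ∧ ∑ i, μ i = 1}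

/-- The permutation `p` ranking the components of `μ` in decreasing order,
ties broken in increasing order of index (stable sort of `-μ`). -/
noncomputable def rankPerm {n : ℕ} (μ : Fin n → ℝ) : Equiv.Perm (Fin n) :=
  Tuple.sort (fun i => -μ i)

/-- The `k`-th reverse order statistic `μ₍ₖ₊₁₎` (0-indexed): `ordStat μ 0` is the
largest component, `ordStat μ (n-1)` the smallest. -/
noncomputable def ordStat {n : ℕ} (μ : Fin n → ℝ) (k : Fin n) : ℝ :=
  μ (rankPerm μ k)

/-- The split-merge prerule `Ř` with diversity parameter `δ`: if `μ₍₁₎ ≥ 1-δ`, the largest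
company (rank 1) is split in half, the new half being placed at the index of rank `n-1`,
whose previous two smallest values (ranks `n-1`, `n`) merge into the index of rank `n`;
otherwise (and when `n < 3`) it is the identity. -/
noncomputable def preRule {n : ℕ} (δ : ℝ) (μ : Fin n → ℝ) : Fin n → ℝ :=
  if hn : 3 ≤ n then
    if ordStat μ ⟨0, by omega⟩ < 1 - δ then μ
    else fun i =>
      if ((rankPerm μ).symm i : ℕ) = 0 then ordStat μ ⟨0, by omega⟩ / 2
      else if ((rankPerm μ).symm i : ℕ) = n - 2 then ordStat μ ⟨0, by omega⟩ / 2
      else if ((rankPerm μ).symm i : ℕ) = n - 1 then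
        ordStat μ ⟨n - 1, by omega⟩ + ordStat μ ⟨n - 2, by omega⟩
      else μ i
  else μ

/-- The entropy function `S(x) = -∑ xᵢ log xᵢ`. -/
noncomputable def entS {n : ℕ} (x : Fin n → ℝ) : ℝ := -∑ i, x i * Real.log (x i)

/-- The components are listed by `ordStat` in decreasing order. -/
theorem ordStat_antitone {n : ℕ} (μ : Fin n → ℝ) : Antitone (ordStat μ) := by
  intro i j hij
  have h := Tuple.monotone_sort (fun i => -μ i) hij
  simp only [Function.comp_apply] at h
  exact neg_le_neg_iff.mp h

theorem le_ordStat_zero {n : ℕ} (h : 0 < n) (μ : Fin n → ℝ) (i : Fin n) :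
    μ i ≤ ordStat μ ⟨0, h⟩ := by
  have h0 := ordStat_antitone μ
    (show (⟨0, h⟩ : Fin n) ≤ (rankPerm μ).symm i from Nat.zero_le _)
  simpa [ordStat] using h0

theorem sum_ordStat {n : ℕ} (μ : Fin n → ℝ) : ∑ k, ordStat μ k = ∑ i, μ i :=
  Equiv.sum_comp (rankPerm μ) μ

/-- The prerule is the identity strictly below the threshold. -/
theorem preRule_of_lt {n : ℕ} (hn : 3 ≤ n) {δ : ℝ} {μ : Fin n → ℝ}
    (h : ordStat μ ⟨0, by omega⟩ < 1 - δ) : preRule δ μ = μ := by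
  simp [preRule, hn, h]

/-- The values of the prerule, indexed by rank, when it acts. -/
theorem preRule_rankPerm {n : ℕ} (hn : 3 ≤ n) {δ : ℝ} {μ : Fin n → ℝ}
    (h : 1 - δ ≤ ordStat μ ⟨0, by omega⟩) (k : Fin n) :
    preRule δ μ (rankPerm μ k) =
      if (k : ℕ) = 0 then ordStat μ ⟨0, by omega⟩ / 2
      else if (k : ℕ) = n - 2 then ordStat μ ⟨0, by omega⟩ / 2
      else if (k : ℕ) = n - 1 then
        ordStat μ ⟨n - 1, by omega⟩ + ordStat μ ⟨n - 2, by omega⟩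
      else ordStat μ k := by
  rw [preRule, dif_pos hn, if_neg (not_lt.mpr h)]
  simp only [Equiv.symm_apply_apply]
  rfl

/-- The prerule preserves total mass. -/
theorem sum_preRule {n : ℕ} (hn : 3 ≤ n) (δ : ℝ) (μ : Fin n → ℝ) :
    ∑ i, preRule δ μ i = ∑ i, μ i := by
  by_cases h : ordStat μ ⟨0, by omega⟩ < 1 - δ
  · rw [preRule_of_lt hn h]
  rw [not_lt] at h
  rw [← Equiv.sum_comp (rankPerm μ) (preRule δ μ), ← sum_ordStat μ]
  have key : ∀ k : Fin n, preRule δ μ (rankPerm μ k) = ordStat μ k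
      + (if k = ⟨0, by omega⟩ then -(ordStat μ ⟨0, by omega⟩ / 2) else 0)
      + (if k = ⟨n - 2, by omega⟩ then
          ordStat μ ⟨0, by omega⟩ / 2 - ordStat μ ⟨n - 2, by omega⟩ else 0)
      + (if k = ⟨n - 1, by omega⟩ then ordStat μ ⟨n - 2, by omega⟩ else 0) := by
    rintro ⟨k, hk⟩
    rw [preRule_rankPerm hn h]
    simp only [Fin.mk.injEq]
    by_cases h0 : k = 0
    · subst h0
      rw [if_pos rfl, if_pos rfl, if_neg (by omega), if_neg (by omega)]
      ring
    by_cases h2 : k = n - 2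
    · subst h2
      rw [if_neg h0, if_pos rfl, if_neg h0, if_pos rfl, if_neg (by omega)]
      ring
    by_cases h1 : k = n - 1
    · subst h1
      rw [if_neg h0, if_neg h2, if_pos rfl, if_neg h0, if_neg h2, if_pos rfl]
      ring
    simp [h0, h1, h2]
  simp only [key, Finset.sum_add_distrib, Finset.sum_ite_eq', Finset.mem_univ, if_true]
  ring

theorem preRule_pos {n : ℕ} (hn : 3 ≤ n) (δ : ℝ) {μ : Fin n → ℝ} (hμ : ∀ i, 0 < μ i)
    (i : Fin n) : 0 < preRule δ μ i := by
  have hpos : ∀ k, 0 < ordStat μ k := fun k => hμ _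
  by_cases h : ordStat μ ⟨0, by omega⟩ < 1 - δ
  · rw [preRule_of_lt hn h]
    exact hμ i
  obtain ⟨k, rfl⟩ := (rankPerm μ).surjective i
  rw [preRule_rankPerm hn (not_lt.mp h)]
  split_ifs
  · exact half_pos (hpos _)
  · exact half_pos (hpos _)
  · exact add_pos (hpos _) (hpos _)
  · exact hpos _

/-- The prerule preserves the open simplex. -/
theorem preRule_mem_simplexPos {n : ℕ} (hn : 3 ≤ n) (δ : ℝ) {μ : Fin n → ℝ}
    (hμ : μ ∈ simplexPos n) : preRule δ μ ∈ simplexPos n :=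
  ⟨preRule_pos hn δ hμ.1, (sum_preRule hn δ μ).trans hμ.2⟩

/-- The two smallest components have average at most that of all but the largest one. -/
theorem two_smallest_le {n : ℕ} (hn : 3 ≤ n) (μ : Fin n → ℝ) :
    2 * ordStat μ ⟨0, by omega⟩
      + ((n : ℝ) - 1) * (ordStat μ ⟨n - 1, by omega⟩ + ordStat μ ⟨n - 2, by omega⟩)
      ≤ 2 * ∑ i, μ i := by
  set T := ordStat μ ⟨0, by omega⟩
  set u := ordStat μ ⟨n - 1, by omega⟩
  set v := ordStat μ ⟨n - 2, by omega⟩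
  have huv : u ≤ v := ordStat_antitone μ (Fin.mk_le_mk.mpr (by omega))
  have key : ∀ k : Fin n, v + (if k = ⟨0, by omega⟩ then T - v else 0)
      + (if k = ⟨n - 1, by omega⟩ then u - v else 0) ≤ ordStat μ k := by
    rintro ⟨k, hk⟩
    simp only [Fin.mk.injEq]
    by_cases h0 : k = 0
    · subst h0
      rw [if_pos rfl, if_neg (by omega)]
      simp [T]
    by_cases h1 : k = n - 1
    · subst h1
      rw [if_neg h0, if_pos rfl]
      simp [u]
    rw [if_neg h0, if_neg h1, add_zero, add_zero]
    exact ordStat_antitone μ (Fin.mk_le_mk.mpr (by omega))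
  have hsum := Finset.sum_le_sum (fun k (_ : k ∈ Finset.univ) => key k)
  simp only [Finset.sum_add_distrib, Finset.sum_ite_eq', Finset.mem_univ, if_true,
    Finset.sum_const, Finset.card_univ, Fintype.card_fin, nsmul_eq_mul, sum_ordStat] at hsum
  have hn' : (3 : ℝ) ≤ n := by exact_mod_cast hn
  nlinarith [mul_nonneg (sub_nonneg.mpr hn') (sub_nonneg.mpr huv)]

/-- If no component exceeds `1 - δ`, one application of the prerule creates no component at or
above `1 - δ`, and brings the largest one below `1 - δ`. -/
theorem preRule_lt_or {n : ℕ} (hn : 3 ≤ n) {δ : ℝ} (hδ : 2 < ((n : ℝ) + 1) * (1 - δ))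
    {μ : Fin n → ℝ} (hμ : μ ∈ simplexPos n) (hle : ∀ i, μ i ≤ 1 - δ) (i : Fin n) :
    preRule δ μ i < 1 - δ ∨ (i ≠ rankPerm μ ⟨0, by omega⟩ ∧ preRule δ μ i = μ i) := by
  by_cases h : ordStat μ ⟨0, by omega⟩ < 1 - δ
  · rw [preRule_of_lt hn h]
    exact Or.inl ((le_ordStat_zero (by omega) μ i).trans_lt h)
  rw [not_lt] at h
  have hT : ordStat μ ⟨0, by omega⟩ = 1 - δ := (hle _).antisymm h
  have hT0 : 0 < 1 - δ := hT ▸ hμ.1 _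
  have hs := two_smallest_le hn μ
  rw [hμ.2, hT] at hs
  have hn' : (3 : ℝ) ≤ n := by exact_mod_cast hn
  obtain ⟨k, rfl⟩ := (rankPerm μ).surjective i
  rw [preRule_rankPerm hn h]
  split_ifs with h0 h2 h1
  · left; linarith
  · left; linarith
  · left; by_contra! hc; nlinarith
  · refine Or.inr ⟨fun he => h0 ?_, rfl⟩
    rw [(rankPerm μ).injective he]

/-- After `m` iterations at most `n - m` components are at or above `1 - δ`. -/
theorem iterate_preRule_spec {n : ℕ} (hn : 3 ≤ n) {δ : ℝ}
    (hδ : 2 < ((n : ℝ) + 1) * (1 - δ)) {μ : Fin n → ℝ} (hμ : μ ∈ simplexPos n)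
    (hle : ∀ i, μ i ≤ 1 - δ) (m : ℕ) :
    (preRule δ)^[m] μ ∈ simplexPos n ∧ (∀ i, (preRule δ)^[m] μ i ≤ 1 - δ) ∧
      (Finset.univ.filter fun i => 1 - δ ≤ (preRule δ)^[m] μ i).card ≤ n - m := by
  induction m with
  | zero => exact ⟨hμ, hle, (Finset.card_le_univ _).trans (by simp)⟩
  | succ m ih =>
    rw [Function.iterate_succ_apply']
    generalize (preRule δ)^[m] μ = ν at ih
    obtain ⟨hν, hνle, hcard⟩ := ih
    have step := preRule_lt_or hn hδ hν hνle
    refine ⟨preRule_mem_simplexPos hn δ hν, fun i => ?_, ?_⟩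
    · rcases step i with h | h
      · exact h.le
      · exact h.2.trans_le (hνle i)
    by_cases h : ordStat ν ⟨0, by omega⟩ < 1 - δ
    · rw [preRule_of_lt hn h, Finset.filter_false_of_mem
        fun i _ => not_le.mpr ((le_ordStat_zero (by omega) ν i).trans_lt h)]
      simp
    have hmem : rankPerm ν ⟨0, by omega⟩ ∈ Finset.univ.filter fun i => 1 - δ ≤ ν i := by
      simpa [ordStat] using h
    have hsub : (Finset.univ.filter fun i => 1 - δ ≤ preRule δ ν i) ⊆
        (Finset.univ.filter fun i => 1 - δ ≤ ν i).erase (rankPerm ν ⟨0, by omega⟩) := by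
      intro i hi
      have hi' := (Finset.mem_filter.mp hi).2
      rcases step i with hlt | ⟨hne, heq⟩
      · exact absurd hi' (not_le.mpr hlt)
      · simpa [hne, heq] using hi'
    have := Finset.card_le_card hsub
    rw [Finset.card_erase_of_mem hmem] at this
    omega

/-- For `n ≥ 3` and `δ ∈ (0,(n-1)/(n+1))`, the split-merge regulation rule
(the `n`-fold composition of the prerule `Ř`) maps any boundary point (`μ₍₁₎ = 1-δ`) of the
regulatory set strictly inside: all resulting weights are `< 1-δ`. -/
theorem splitMerge_rule_into_open_regulatory_set
    (n : ℕ) (hn : 3 ≤ n) (δ : ℝ)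
    (hδ : δ ∈ Set.Ioo (0 : ℝ) (((n : ℝ) - 1) / ((n : ℝ) + 1)))
    (μ : Fin n → ℝ) (hμ : μ ∈ simplexPos n)
    (htop : ordStat μ ⟨0, by omega⟩ = 1 - δ) :
    ∀ i, (preRule δ)^[n] μ i < 1 - δ := by
  have hle : ∀ i, μ i ≤ 1 - δ := fun i => htop ▸ le_ordStat_zero (by omega) μ i
  have hδ' : 2 < ((n : ℝ) + 1) * (1 - δ) := by
    have h := (lt_div_iff₀ (by positivity)).mp hδ.2
    linarith
  have hcard := (iterate_preRule_spec hn hδ' hμ hle n).2.2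
  rw [Nat.sub_self, Nat.le_zero, Finset.card_eq_zero, Finset.filter_eq_empty_iff] at hcard
  exact fun i => not_le.mp (hcard (Finset.mem_univ i))
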